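/- Let μ ∈ ℝ and σ > 0, and define h_{μ,σ}(y) = (μ − y)·Φ((μ − y)/σ) + σ·φ((μ − y)/σ). Then h_{μ,σ}(y) > 0 for every y ∈ ℝ; h_{μ,σ}(y) → 0 as y → +∞; and h_{μ,σ}(y) → +∞ as y → −∞. -/

import Mathlib

open Filter Topology

/-- The standard normal density `φ(t) = (2π)^{-1/2} exp(−t²/2)`. -/
noncomputable def stdNormalPDF (t : ℝ) : ℝ :=
  (Real.sqrt (2 * Real.pi))⁻¹ * Real.exp (-t ^ 2 / 2)

/-- The standard normal cumulative distribution function `Φ(t) = ∫_{−∞}^t φ(s) ds`. -/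
noncomputable def stdNormalCDF (t : ℝ) : ℝ :=
  ∫ s in Set.Iio t, stdNormalPDF s

/-- The Gaussian expected-improvement function
`h_{μ,σ}(y) = (μ − y)·Φ((μ − y)/σ) + σ·φ((μ − y)/σ)`. -/
noncomputable def gaussianEI (μ σ y : ℝ) : ℝ :=
  (μ - y) * stdNormalCDF ((μ - y) / σ) + σ * stdNormalPDF ((μ - y) / σ)

open MeasureTheory in
theorem integrable_stdNormalPDF : Integrable stdNormalPDF := by
  refine ((integrable_exp_neg_mul_sq (b := 1 / 2) (by norm_num)).const_mul
    (Real.sqrt (2 * Real.pi))⁻¹).congr (.of_forall fun t => ?_)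
  simp only [stdNormalPDF]
  ring_nf

open MeasureTheory in
theorem integrable_mul_stdNormalPDF : Integrable fun t => t * stdNormalPDF t := by
  refine ((integrable_mul_exp_neg_mul_sq (b := 1 / 2) (by norm_num)).const_mul
    (Real.sqrt (2 * Real.pi))⁻¹).congr (.of_forall fun t => ?_)
  simp only [stdNormalPDF]
  ring_nf

theorem stdNormalPDF_pos (t : ℝ) : 0 < stdNormalPDF t := by
  have := Real.pi_pos
  unfold stdNormalPDF
  positivity

theorem tendsto_stdNormalPDF_atBot : Tendsto stdNormalPDF atBot (𝓝 0) := by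
  have hsq : Tendsto (fun t : ℝ => -t ^ 2 / 2) atBot atBot := by
    have h : Tendsto (fun t : ℝ => t ^ 2) atBot atTop := by
      simpa [pow_two] using tendsto_id.atBot_mul_atBot₀ (tendsto_id (α := ℝ) (x := atBot))
    exact (tendsto_neg_atTop_atBot.comp h).atBot_div_const two_pos
  have h := (Real.tendsto_exp_atBot.comp hsq).const_mul (Real.sqrt (2 * Real.pi))⁻¹
  rwa [mul_zero] at h

theorem hasDerivAt_stdNormalPDF (t : ℝ) :
    HasDerivAt stdNormalPDF (-(t * stdNormalPDF t)) t := by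
  have h : HasDerivAt (fun s : ℝ => -s ^ 2 / 2) (-t) t := by
    refine ((hasDerivAt_pow 2 t).neg.div_const 2).congr_deriv ?_
    norm_num
    ring
  refine (h.exp.const_mul (Real.sqrt (2 * Real.pi))⁻¹).congr_deriv ?_
  simp only [stdNormalPDF]
  ring

theorem setIntegral_Iio_mul_stdNormalPDF (t : ℝ) :
    ∫ s in Set.Iio t, s * stdNormalPDF s = -stdNormalPDF t := by
  have h := MeasureTheory.integral_Iic_of_hasDerivAt_of_tendsto' (a := t)
    (fun s _ => hasDerivAt_stdNormalPDF s) integrable_mul_stdNormalPDF.neg.integrableOn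
    tendsto_stdNormalPDF_atBot
  rw [MeasureTheory.integral_neg, MeasureTheory.integral_Iic_eq_integral_Iio] at h
  linarith

theorem stdNormalCDF_pos (t : ℝ) : 0 < stdNormalCDF t := by
  refine (MeasureTheory.setIntegral_pos_iff_support_of_nonneg_ae
    (.of_forall fun s => (stdNormalPDF_pos s).le) integrable_stdNormalPDF.integrableOn).2 ?_
  simp [Function.support, (stdNormalPDF_pos _).ne']

theorem stdNormalCDF_mono : Monotone stdNormalCDF := fun _ _ h =>
  MeasureTheory.setIntegral_mono_set integrable_stdNormalPDF.integrableOn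
    (.of_forall fun s => (stdNormalPDF_pos s).le) (Set.Iio_subset_Iio h).eventuallyLE

theorem mul_stdNormalCDF_add_stdNormalPDF_eq_setIntegral (t : ℝ) :
    t * stdNormalCDF t + stdNormalPDF t = ∫ s in Set.Iio t, (t - s) * stdNormalPDF s := by
  simp_rw [sub_mul]
  rw [MeasureTheory.integral_sub (integrable_stdNormalPDF.const_mul t).integrableOn
    integrable_mul_stdNormalPDF.integrableOn, MeasureTheory.integral_const_mul,
    setIntegral_Iio_mul_stdNormalPDF, stdNormalCDF]
  ring

theorem mul_stdNormalCDF_add_stdNormalPDF_pos (t : ℝ) :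
    0 < t * stdNormalCDF t + stdNormalPDF t := by
  rw [mul_stdNormalCDF_add_stdNormalPDF_eq_setIntegral]
  have hpos : ∀ s ∈ Set.Iio t, 0 < (t - s) * stdNormalPDF s := fun s hs =>
    mul_pos (sub_pos.2 hs) (stdNormalPDF_pos s)
  have hint : MeasureTheory.Integrable fun s => (t - s) * stdNormalPDF s := by
    simp_rw [sub_mul]
    exact (integrable_stdNormalPDF.const_mul t).sub integrable_mul_stdNormalPDF
  refine (MeasureTheory.setIntegral_pos_iff_support_of_nonneg_ae
    (MeasureTheory.ae_restrict_of_forall_mem measurableSet_Iio fun s hs => (hpos s hs).le)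
    hint.integrableOn).2 ?_
  have hsub : Set.Iio t ⊆ Function.support fun s => (t - s) * stdNormalPDF s :=
    fun s hs => (hpos s hs).ne'
  rw [Set.inter_eq_right.2 hsub]
  simp

theorem tendsto_mul_stdNormalCDF_add_stdNormalPDF_atBot :
    Tendsto (fun t => t * stdNormalCDF t + stdNormalPDF t) atBot (𝓝 0) := by
  refine squeeze_zero' (.of_forall fun t => (mul_stdNormalCDF_add_stdNormalPDF_pos t).le) ?_
    tendsto_stdNormalPDF_atBot
  filter_upwards [eventually_le_atBot 0] with t ht
  linarith [mul_nonpos_of_nonpos_of_nonneg ht (stdNormalCDF_pos t).le]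

theorem tendsto_mul_stdNormalCDF_add_stdNormalPDF_atTop :
    Tendsto (fun t => t * stdNormalCDF t + stdNormalPDF t) atTop atTop := by
  refine tendsto_atTop_mono' atTop ?_ (tendsto_id.atTop_mul_const (stdNormalCDF_pos 0))
  filter_upwards [eventually_ge_atTop 0] with t ht
  have := mul_le_mul_of_nonneg_left (stdNormalCDF_mono ht) ht
  simp only [id]
  linarith [stdNormalPDF_pos t]

theorem gaussianEI_eq_mul {σ : ℝ} (hσ : σ ≠ 0) (μ y : ℝ) :
    gaussianEI μ σ y = σ * ((μ - y) / σ * stdNormalCDF ((μ - y) / σ) +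
      stdNormalPDF ((μ - y) / σ)) := by
  rw [gaussianEI, mul_add, ← mul_assoc, mul_div_cancel₀ _ hσ]

/-- `h_{μ,σ}` is everywhere positive, tends to `0` at `+∞`, and to `+∞` at `−∞`. -/
theorem gaussianEI_pos_and_limits (μ σ : ℝ) (hσ : 0 < σ) :
    (∀ y : ℝ, 0 < gaussianEI μ σ y) ∧
    Tendsto (gaussianEI μ σ) atTop (𝓝 0) ∧
    Tendsto (gaussianEI μ σ) atBot atTop := by
  have hTop : Tendsto (fun y => (μ - y) / σ) atTop atBot := by
    simp_rw [sub_eq_add_neg]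
    exact (tendsto_atBot_add_const_left _ μ tendsto_neg_atTop_atBot).atBot_div_const hσ
  have hBot : Tendsto (fun y => (μ - y) / σ) atBot atTop := by
    simp_rw [sub_eq_add_neg]
    exact (tendsto_atTop_add_const_left _ μ tendsto_neg_atBot_atTop).atTop_div_const hσ
  rw [funext (gaussianEI_eq_mul hσ.ne' μ)]
  refine ⟨fun y => mul_pos hσ (mul_stdNormalCDF_add_stdNormalPDF_pos _), ?_, ?_⟩
  · simpa using (tendsto_mul_stdNormalCDF_add_stdNormalPDF_atBot.comp hTop).const_mul σ
  · exact (tendsto_mul_stdNormalCDF_add_stdNormalPDF_atTop.comp hBot).const_mul_atTop hσ
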